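/- Let ω ∈ ℂ with Im ω > 0, let Λ = {n + m·ω : n, m ∈ ℤ} ⊂ ℂ, and let a, b ∈ ℂ satisfy a·Λ ⊆ Λ and |a|² ≥ 2. Let A : ℂ/Λ → ℂ/Λ be the map induced by z ↦ a·z + b. If E ⊆ ℂ/Λ is an eventually simply-connected wandering continuum for A, then there exist a line L ⊂ ℂ on which the quotient map π is injective and a nondegenerate line segment B ⊆ L such that E = π(B); that is, E is a line segment contained in an infinite geodesic of the flat torus ℂ/Λ. -/

import Mathlib

open Complex

/-- The lattice Λ = {n + m·ω : n, m ∈ ℤ} as an additive subgroup of ℂ. -/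
noncomputable def Lambda (ω : ℂ) : AddSubgroup ℂ where
  carrier := {z : ℂ | ∃ n m : ℤ, z = (n : ℂ) + (m : ℂ) * ω}
  add_mem' := by
    rintro x y ⟨n1, m1, rfl⟩ ⟨n2, m2, rfl⟩
    exact ⟨n1 + n2, m1 + m2, by push_cast; ring⟩
  zero_mem' := ⟨0, 0, by simp⟩
  neg_mem' := by
    rintro x ⟨n, m, rfl⟩
    exact ⟨-n, -m, by push_cast; ring⟩

/-- The quotient map π : ℂ → ℂ/Λ. -/
noncomputable def pr (ω : ℂ) : ℂ → ℂ ⧸ Lambda ω := QuotientAddGroup.mk' (Lambda ω)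

/-- A line in ℂ. -/
def IsLine (L : Set ℂ) : Prop :=
  ∃ z₀ v : ℂ, v ≠ 0 ∧ L = {z | ∃ t : ℝ, z = z₀ + t * v}

/-- A nondegenerate line segment in ℂ. -/
def IsSegment (B : Set ℂ) : Prop :=
  ∃ z₀ v : ℂ, v ≠ 0 ∧ B = {z | ∃ t : ℝ, t ∈ Set.Icc (0 : ℝ) 1 ∧ z = z₀ + t * v}

/-- A continuum: a compact connected set with more than one point. -/
def IsContinuum {X : Type*} [TopologicalSpace X] (E : Set X) : Prop :=
  IsCompact E ∧ IsConnected E ∧ E.Nontrivial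

/-- E is wandering for A. -/
def Wandering {X : Type*} (A : X → X) (E : Set X) : Prop :=
  ∀ n m : ℕ, m < n → A^[n] '' E ∩ A^[m] '' E = ∅

/-- A continuum in the torus is simply-connected. -/
def IsSCContinuum (ω : ℂ) (E : Set (ℂ ⧸ Lambda ω)) : Prop :=
  ∃ U : Set (ℂ ⧸ Lambda ω), IsOpen U ∧ SimplyConnectedSpace U ∧ E ⊆ U ∧ IsConnected (U \ E)

section Auxiliary

open scoped Pointwise ComplexConjugate
open Set Filter Topology Metric

/-- The identity on a circle centred at `0` has no continuous logarithm. -/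
theorem not_exists_continuous_log_on_circle {R : ℝ} (hR : 0 < R) (l : ℂ → ℂ)
    (hl : ContinuousOn l (sphere 0 R)) (h : ∀ z ∈ sphere (0 : ℂ) R, exp (l z) = z) : False := by
  have hmem : ∀ θ : ℝ, circleMap 0 R θ ∈ sphere (0 : ℂ) R :=
    fun θ ↦ circleMap_mem_sphere 0 hR.le θ
  set g : ℝ → ℂ := fun θ ↦ l (circleMap 0 R θ) - θ * I
  have hg : Continuous g := by
    refine Continuous.sub ?_ (by fun_prop)
    exact hl.comp_continuous (continuous_circleMap 0 R) hmem
  have hexp : ∀ θ, exp (g θ) = R := by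
    intro θ
    have h1 := h _ (hmem θ)
    rw [Complex.exp_sub, h1, circleMap_zero]
    exact mul_div_cancel_right₀ _ (Complex.exp_ne_zero _)
  have hcount : (range g).Countable := by
    have : range g ⊆ range (fun n : ℤ ↦ g 0 + n * (2 * Real.pi * I)) := by
      rintro _ ⟨θ, rfl⟩
      obtain ⟨n, hn⟩ := Complex.exp_eq_exp_iff_exists_int.1 ((hexp θ).trans (hexp 0).symm)
      exact ⟨n, hn.symm⟩
    exact (countable_range _).mono this
  have hsub := hcount.isTotallyDisconnected _ subset_rfl (isPreconnected_range hg)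
  have h0 := hsub (mem_range_self 0) (mem_range_self (2 * Real.pi))
  have hper : circleMap 0 R (2 * Real.pi) = circleMap 0 R 0 := by
    simpa using periodic_circleMap 0 R 0
  simp only [g, hper] at h0
  have := Complex.ext_iff.1 h0
  simp at this
  linarith [Real.pi_pos]

theorem isSimplyConnected_univ_complex : IsSimplyConnected (univ : Set ℂ) := by
  have := (Homeomorph.Set.univ ℂ).toHomotopyEquiv.contractibleSpace
  exact SimplyConnectedSpace.ofContractible (univ : Set ℂ)

/-- A continuous self-map of the plane at bounded distance from the identity is surjective. -/
theorem surjective_of_bounded_sub_id {f : ℂ → ℂ} (hf : Continuous f) {C : ℝ}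
    (hC : ∀ z, ‖f z - z‖ ≤ C) : Function.Surjective f := by
  intro w
  by_contra! hw
  obtain ⟨h, hh, hexp⟩ := exists_continuousOn_eqOn_exp_comp (X := ℂ) (U := univ)
    (g := fun z ↦ f z - w) isSimplyConnected_univ_complex isOpen_univ (by fun_prop)
    (by rintro ⟨z, -, hz⟩; exact hw z (sub_eq_zero.1 hz))
  have hC0 : 0 ≤ C := (norm_nonneg _).trans (hC 0)
  set R : ℝ := C + ‖w‖ + 1
  have hR : 0 < R := by positivity
  have hz0 : ∀ z ∈ sphere (0 : ℂ) R, z ≠ 0 := by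
    rintro z hz rfl
    simp at hz; linarith
  have hslit : ∀ z ∈ sphere (0 : ℂ) R, (f z - w) / z ∈ slitPlane := by
    intro z hz
    have hzR : ‖z‖ = R := by simpa using hz
    refine Or.inl ?_
    have h1 : (f z - w) / z = 1 + (f z - z - w) / z := by
      field_simp [hz0 z hz]; ring
    have h2 : ‖(f z - z - w) / z‖ < 1 := by
      rw [norm_div, hzR, div_lt_one hR]
      calc _ ≤ ‖f z - z‖ + ‖w‖ := norm_sub_le _ _
        _ < R := by have := hC z; simp only [R]; linarith
    have h3 := (abs_le.1 (abs_re_le_norm ((f z - z - w) / z))).1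
    rw [h1, add_re, one_re]; linarith
  refine not_exists_continuous_log_on_circle hR (fun z ↦ h z - Complex.log ((f z - w) / z)) ?_ ?_
  · refine (hh.mono (subset_univ _)).sub (ContinuousOn.clog ?_ hslit)
    exact ContinuousOn.div (by fun_prop) continuousOn_id hz0
  · intro z hz
    have h1 := hexp (mem_univ z)
    simp only [Function.comp_apply] at h1
    have h2 : f z - w ≠ 0 := sub_ne_zero.2 (hw z)
    rw [Complex.exp_sub, h1, Complex.exp_log (div_ne_zero h2 (hz0 z hz))]
    field_simp

/-- Two complex numbers that are not real multiples of each other give linear coordinates. -/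
theorem exists_coordinates {u v : ℂ} (h : (conj u * v).im ≠ 0) :
    ∃ e : (ℝ × ℝ) ≃L[ℝ] ℂ, ∀ s t : ℝ, e (s, t) = s * u + t * v := by
  let f : (ℝ × ℝ) →ₗ[ℝ] ℂ :=
    (LinearMap.toSpanSingleton ℝ ℂ u).coprod (LinearMap.toSpanSingleton ℝ ℂ v)
  have hf : ∀ s t : ℝ, f (s, t) = s * u + t * v := by intro s t; simp [f]
  have hinj : Function.Injective f := by
    rw [← LinearMap.ker_eq_bot, LinearMap.ker_eq_bot']
    rintro ⟨s, t⟩ h0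
    rw [hf] at h0
    have hre := congrArg re h0
    have him := congrArg im h0
    simp only [add_re, mul_re, ofReal_re, ofReal_im, zero_mul, sub_zero, zero_re, add_im, mul_im,
      add_zero, zero_im, conj_re, conj_im] at hre him h
    have hs : s * (u.re * v.im + -u.im * v.re) = 0 := by linear_combination v.im * hre - v.re * him
    have ht : t * (u.re * v.im + -u.im * v.re) = 0 := by linear_combination u.re * him - u.im * hre
    simp [(mul_eq_zero.1 hs).resolve_right h, (mul_eq_zero.1 ht).resolve_right h]
  have hdim : Module.finrank ℝ (ℝ × ℝ) = Module.finrank ℝ ℂ := by simp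
  refine ⟨(LinearEquiv.ofInjectiveOfFinrankEq f hinj hdim).toContinuousLinearEquiv, fun s t ↦ ?_⟩
  rw [← hf]; rfl

/-- The integer combinations of two independent complex numbers form an embedded lattice. -/
theorem isClosedEmbedding_int_combination {u v : ℂ} (h : (conj u * v).im ≠ 0) :
    IsClosedEmbedding fun p : ℤ × ℤ ↦ (p.1 * u + p.2 * v : ℂ) := by
  obtain ⟨e, he⟩ := exists_coordinates h
  convert e.toHomeomorph.isClosedEmbedding.comp
    (Int.isClosedEmbedding_coe_real.prodMap Int.isClosedEmbedding_coe_real) using 2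
  simp [he]

/-- A path from `γ 0` to `γ 0 + u`, continued quasi-periodically, crosses every translate of
a path from `δ 0` to `δ 0 + v` continued in the same way. -/
theorem exists_crossing {u v : ℂ} (h : (conj u * v).im ≠ 0) {γ δ : ℝ → ℂ}
    (hγ : ContinuousOn γ (Icc 0 1)) (hδ : ContinuousOn δ (Icc 0 1))
    (hu : γ 1 = γ 0 + u) (hv : δ 1 = δ 0 + v) (z : ℂ) :
    ∃ s ∈ Icc (0 : ℝ) 1, ∃ t ∈ Icc (0 : ℝ) 1, ∃ j k : ℤ, z = γ s - δ t + (j * u + k * v) := by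
  have bounded : ∀ {η : ℝ → ℂ} {w : ℂ}, ContinuousOn η (Icc 0 1) → η 1 = η 0 + w →
      ∃ C, Continuous (fun s : ℝ ↦ η (Int.fract s) - Int.fract s * w) ∧
        ∀ s : ℝ, ‖η (Int.fract s) - Int.fract s * w‖ ≤ C := by
    intro η w hη hw
    have hc : ContinuousOn (fun s : ℝ ↦ η s - s * w) (Icc 0 1) := hη.sub (by fun_prop)
    obtain ⟨C, hC⟩ := isCompact_Icc.exists_bound_of_continuousOn hc
    exact ⟨C, hc.comp_fract'' (by simp [hw]),
      fun s ↦ hC _ ⟨Int.fract_nonneg s, (Int.fract_lt_one s).le⟩⟩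
  obtain ⟨C, hcγ, hC⟩ := bounded hγ hu
  obtain ⟨D, hcδ, hD⟩ := bounded hδ hv
  obtain ⟨e, he⟩ := exists_coordinates h
  set g : ℝ → ℂ := fun s ↦ γ (Int.fract s) - Int.fract s * u
  set d : ℝ → ℂ := fun s ↦ δ (Int.fract s) - Int.fract s * v
  obtain ⟨w, hw⟩ := surjective_of_bounded_sub_id
    (f := fun w ↦ w + (g (e.symm w).1 - d (-(e.symm w).2))) (by fun_prop) (C := C + D) (by
      intro w
      rw [add_sub_cancel_left]
      exact (norm_sub_le _ _).trans (add_le_add (hC _) (hD _))) z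
  obtain ⟨s, t, hst⟩ : ∃ s t : ℝ, e.symm w = (s, t) := ⟨_, _, rfl⟩
  have hw' : w = s * u + t * v := by rw [← he, ← hst, e.apply_symm_apply]
  refine ⟨Int.fract s, ⟨Int.fract_nonneg s, (Int.fract_lt_one s).le⟩,
    Int.fract (-t), ⟨Int.fract_nonneg _, (Int.fract_lt_one _).le⟩, ⌊s⌋, -⌊-t⌋, ?_⟩
  rw [← hw]
  simp only [hst, g, d]
  rw [hw', Int.fract, Int.fract]
  push_cast
  ring

theorem IsCompact.sub_self {F : Set ℂ} (hF : IsCompact F) : IsCompact (F - F) := by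
  rw [sub_eq_add_neg]
  exact hF.add hF.neg

theorem isPreconnected_thickening {F : Set ℂ} (hF : IsPreconnected F) (δ : ℝ) :
    IsPreconnected (thickening δ F) := by
  rw [← add_ball_zero, ← add_image_prod]
  exact (hF.prod (convex_ball (0 : ℂ) δ).isPreconnected).image _ (by fun_prop)

/-- If a continuum contains three noncollinear points then its difference set, translated by
the lattice these points span, covers the plane. -/
theorem exists_mem_sub_add_int_combination {F : Set ℂ} (hF : IsCompact F)
    (hc : IsPreconnected F) {p q r : ℂ} (hp : p ∈ F) (hq : q ∈ F) (hr : r ∈ F)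
    (h : (conj (q - p) * (r - p)).im ≠ 0) (z : ℂ) :
    z ∈ (F - F) + range fun n : ℤ × ℤ ↦ (n.1 * (q - p) + n.2 * (r - p) : ℂ) := by
  have hclosed :=
    (isClosedEmbedding_int_combination h).isClosed_range.add_left_of_isCompact hF.sub_self
  rw [← hclosed.closure_eq, Metric.mem_closure_iff]
  intro ε hε
  have hpath : IsPathConnected (thickening (ε / 2) F) :=
    isOpen_thickening.isConnected_iff_isPathConnected.1
      ⟨⟨p, self_subset_thickening (half_pos hε) F hp⟩, isPreconnected_thickening hc _⟩
  have join : ∀ w ∈ F, ∃ γ : ℝ → ℂ, Continuous γ ∧ γ 0 = p ∧ γ 1 = w ∧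
      ∀ t, γ t ∈ thickening (ε / 2) F := by
    intro w hw
    have hj := hpath.joinedIn p (self_subset_thickening (half_pos hε) F hp) w
      (self_subset_thickening (half_pos hε) F hw)
    exact ⟨hj.somePath.extend, by fun_prop, by simp, by simp, fun t ↦ hj.somePath_mem _⟩
  obtain ⟨γ, hγ, hγ0, hγ1, hγF⟩ := join q hq
  obtain ⟨δ, hδ, hδ0, hδ1, hδF⟩ := join r hr
  obtain ⟨s, -, t, -, j, k, hz⟩ := exists_crossing h hγ.continuousOn hδ.continuousOn
    (by rw [hγ0, hγ1]; ring) (by rw [hδ0, hδ1]; ring) z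
  obtain ⟨x, hx, hxs⟩ := mem_thickening_iff.1 (hγF s)
  obtain ⟨y, hy, hyt⟩ := mem_thickening_iff.1 (hδF t)
  refine ⟨_, add_mem_add (sub_mem_sub hx hy) (mem_range_self (j, k)), ?_⟩
  rw [hz, dist_add_right]
  calc _ ≤ dist (γ s) x + dist (δ t) y := dist_sub_sub_le _ _ _ _
    _ < ε := by linarith

/-- The difference set of a planar continuum that is not contained in a line has interior. -/
theorem nonempty_interior_sub_self {F : Set ℂ} (hF : IsCompact F)
    (hc : IsPreconnected F) {p q r : ℂ} (hp : p ∈ F) (hq : q ∈ F) (hr : r ∈ F)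
    (h : (conj (q - p) * (r - p)).im ≠ 0) : (interior (F - F)).Nonempty := by
  obtain ⟨n, w, hw⟩ := nonempty_interior_of_iUnion_of_closed
    (f := fun n : ℤ × ℤ ↦ (fun w ↦ w + (n.1 * (q - p) + n.2 * (r - p) : ℂ)) '' (F - F))
    (fun n ↦ (((hF.sub_self).image (by fun_prop)).isClosed))
    (by
      refine eq_univ_of_forall fun z ↦ ?_
      obtain ⟨d, hd, _, ⟨n, rfl⟩, rfl⟩ := exists_mem_sub_add_int_combination hF hc hp hq hr h z
      exact mem_iUnion.2 ⟨n, d, hd, rfl⟩)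
  change w ∈ interior ((Homeomorph.addRight (n.1 * (q - p) + n.2 * (r - p) : ℂ)) '' (F - F)) at hw
  rw [← Homeomorph.image_interior] at hw
  exact image_nonempty.1 ⟨w, hw⟩

/-- A planar continuum whose difference set has empty interior is a segment or a point. -/
theorem exists_segment_of_interior_sub_self_eq_empty {F : Set ℂ} (hF : IsCompact F)
    (hc : IsConnected F) (h : interior (F - F) = ∅) :
    ∃ z₀ v : ℂ, F = {z | ∃ t : ℝ, t ∈ Icc (0 : ℝ) 1 ∧ z = z₀ + t * v} := by
  have hcol : ∀ p ∈ F, ∀ q ∈ F, ∀ r ∈ F, (conj (q - p) * (r - p)).im = 0 := by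
    intro p hp q hq r hr
    by_contra hne
    exact (nonempty_interior_sub_self hF hc.isPreconnected hp hq hr hne).ne_empty h
  obtain ⟨p, hp⟩ := hc.nonempty
  by_cases hsub : F.Subsingleton
  · refine ⟨p, 0, ?_⟩
    rw [hsub.eq_singleton_of_mem hp]
    ext z
    simpa using fun _ ↦ ⟨0, by simp⟩
  obtain ⟨q, hq, hqp⟩ := (not_subsingleton_iff.1 hsub).exists_ne p
  have hu : q - p ≠ 0 := sub_ne_zero.2 hqp
  set u := q - p
  set f : ℂ → ℝ := fun z ↦ (conj u * (z - p)).re / normSq u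
  have hf : Continuous f := by fun_prop
  have hfF : ∀ z ∈ F, z = p + f z * u := by
    intro z hz
    have h1 : conj u * (z - p) = ((conj u * (z - p)).re : ℂ) :=
      Complex.ext rfl (by rw [ofReal_im]; exact hcol p hp q hq z hz)
    have h2 : (normSq u : ℂ) ≠ 0 := by simpa using hu
    have h3 : (f z : ℂ) = conj u * (z - p) / normSq u := by
      rw [h1]; simp [f]
    have h4 : conj u ≠ 0 := by simpa using hu
    rw [h3, normSq_eq_conj_mul_self]
    field_simp
    ring
  have hI := eq_Icc_of_connected_compact (hc.image f hf.continuousOn) (hF.image hf)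
  set α := sInf (f '' F)
  set β := sSup (f '' F)
  refine ⟨p + α * u, (β - α) * u, ?_⟩
  ext z
  constructor
  · intro hz
    have hzI : f z ∈ Icc α β := hI ▸ mem_image_of_mem f hz
    obtain ⟨t, ht, hft⟩ : f z ∈ (fun t ↦ α + t * (β - α)) '' Icc 0 1 := by
      have := segment_eq_image' ℝ α β
      rw [segment_eq_Icc (hzI.1.trans hzI.2)] at this
      simpa [this] using hzI
    refine ⟨t, ht, ?_⟩
    rw [hfF z hz, ← hft]; push_cast; ring
  · rintro ⟨t, ht, rfl⟩
    have hαβ : α ≤ β := by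
      have := hI ▸ mem_image_of_mem f hp
      exact this.1.trans this.2
    have : α + t * (β - α) ∈ f '' F := by
      rw [hI]
      constructor <;> nlinarith [ht.1, ht.2]
    obtain ⟨w, hw, hfw⟩ := this
    convert hw using 1
    rw [hfF w hw, hfw]; push_cast; ring
section Torus

variable {ω a b : ℂ}

theorem pr_eq_pr_iff {z w : ℂ} : pr ω z = pr ω w ↔ z - w ∈ Lambda ω := by
  rw [← neg_mem_iff, neg_sub, ← neg_add_eq_sub]
  exact QuotientAddGroup.eq

theorem pr_add (z w : ℂ) : pr ω (z + w) = pr ω z + pr ω w := rfl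

theorem pr_surjective : Function.Surjective (pr ω) := QuotientAddGroup.mk_surjective

theorem isQuotientMap_pr : IsQuotientMap (pr ω) := isQuotientMap_quotient_mk'

theorem continuous_pr : Continuous (pr ω) := isQuotientMap_pr.continuous

theorem coe_Lambda : (Lambda ω : Set ℂ) = range fun p : ℤ × ℤ ↦ (p.1 * 1 + p.2 * ω : ℂ) := by
  ext z
  constructor
  · rintro ⟨n, m, rfl⟩
    exact ⟨(n, m), by simp⟩
  · rintro ⟨p, rfl⟩
    exact ⟨p.1, p.2, by simp⟩

theorem countable_Lambda : (Lambda ω : Set ℂ).Countable :=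
  coe_Lambda (ω := ω) ▸ countable_range _

theorem isClosedEmbedding_Lambda (hω : 0 < ω.im) :
    IsClosedEmbedding fun p : ℤ × ℤ ↦ (p.1 * 1 + p.2 * ω : ℂ) :=
  isClosedEmbedding_int_combination (by simpa using hω.ne')

theorem isClosed_Lambda (hω : 0 < ω.im) : IsClosed (Lambda ω : Set ℂ) :=
  coe_Lambda (ω := ω) ▸ (isClosedEmbedding_Lambda hω).isClosed_range

theorem isDiscrete_Lambda (hω : 0 < ω.im) : IsDiscrete (Lambda ω : Set ℂ) := by
  rw [coe_Lambda]
  exact ⟨(isClosedEmbedding_Lambda hω).isEmbedding.toHomeomorph.symm.isEmbedding.discreteTopology⟩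

theorem isCoveringMap_pr (hω : 0 < ω.im) : IsCoveringMap (pr ω) :=
  ((Lambda ω).isAddQuotientCoveringMap_of_comm (isDiscrete_Lambda hω)).isCoveringMap

/-- Every point of the plane is within a fixed distance of the lattice. -/
theorem exists_mem_Lambda_norm_sub_le (hω : 0 < ω.im) (z : ℂ) :
    ∃ l ∈ Lambda ω, ‖z - l‖ ≤ 1 + ‖ω‖ := by
  obtain ⟨e, he⟩ := exists_coordinates (u := 1) (v := ω) (by simpa using hω.ne')
  obtain ⟨⟨s, t⟩, rfl⟩ := e.surjective z
  refine ⟨⌊s⌋ + ⌊t⌋ * ω, ⟨_, _, rfl⟩, ?_⟩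
  have h1 : e (s, t) - (⌊s⌋ + ⌊t⌋ * ω) = (Int.fract s : ℝ) + (Int.fract t : ℝ) * ω := by
    rw [he, Int.fract, Int.fract]; push_cast; ring
  rw [h1]
  refine (norm_add_le _ _).trans ?_
  rw [norm_mul, norm_real, norm_real, Real.norm_of_nonneg (Int.fract_nonneg s),
    Real.norm_of_nonneg (Int.fract_nonneg t)]
  exact add_le_add (Int.fract_lt_one s).le
    (mul_le_of_le_one_left (norm_nonneg _) (Int.fract_lt_one t).le)

/-- The quotient map has a continuous section over a simply connected open set. -/
theorem exists_section_pr (hω : 0 < ω.im) {U : Set (ℂ ⧸ Lambda ω)} (hU : IsOpen U)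
    (hsc : SimplyConnectedSpace U) :
    ∃ σ : ℂ ⧸ Lambda ω → ℂ, ContinuousOn σ U ∧ ∀ x ∈ U, pr ω (σ x) = x := by
  classical
  have : LocallyPathConnectedSpace (ℂ ⧸ Lambda ω) :=
    isQuotientMap_pr.locallyPathConnectedSpace
  have := hU.locallyPathConnectedSpace
  obtain ⟨x₀⟩ : Nonempty U := inferInstance
  obtain ⟨e₀, he₀⟩ := pr_surjective x₀.1
  obtain ⟨f, ⟨-, hf⟩, -⟩ := (isCoveringMap_pr hω).existsUnique_continuousMap_lifts
    ⟨((↑) : U → ℂ ⧸ Lambda ω), continuous_subtype_val⟩ x₀ e₀ he₀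
  refine ⟨fun x ↦ if hx : x ∈ U then f ⟨x, hx⟩ else 0, ?_, ?_⟩
  · rw [continuousOn_iff_continuous_domRestrict]
    convert f.continuous using 1
    ext x
    simp
  · intro x hx
    simpa [hx] using congrFun hf ⟨x, hx⟩

/-- A connected plane set projecting into a simply connected open set projects injectively. -/
theorem injOn_pr_of_isPreconnected (hω : 0 < ω.im) {U : Set (ℂ ⧸ Lambda ω)} (hU : IsOpen U)
    (hsc : SimplyConnectedSpace U) {G : Set ℂ} (hG : IsPreconnected G)
    (hGU : MapsTo (pr ω) G U) : InjOn (pr ω) G := by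
  obtain ⟨σ, hσ, hσU⟩ := exists_section_pr hω hU hsc
  have hcont : ContinuousOn (fun z ↦ z - σ (pr ω z)) G :=
    continuousOn_id.sub (hσ.comp continuous_pr.continuousOn hGU)
  have hsub : (fun z ↦ z - σ (pr ω z)) '' G ⊆ Lambda ω := by
    rintro _ ⟨z, hz, rfl⟩
    exact pr_eq_pr_iff.1 (hσU _ (hGU hz)).symm
  have hconst := countable_Lambda.isTotallyDisconnected _ hsub (hG.image _ hcont)
  intro z hz w hw h
  have := hconst (mem_image_of_mem _ hz) (mem_image_of_mem _ hw)
  simpa [h] using this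

theorem iterate_affine_sub (n : ℕ) (z w : ℂ) :
    (fun z ↦ a * z + b)^[n] z - (fun z ↦ a * z + b)^[n] w = a ^ n * (z - w) := by
  induction n with
  | zero => simp
  | succ n ih =>
    rw [Function.iterate_succ_apply', Function.iterate_succ_apply', pow_succ', mul_assoc, ← ih]
    ring

theorem pow_mul_mem_Lambda (hab : ∀ z ∈ Lambda ω, a * z ∈ Lambda ω) (n : ℕ) {z : ℂ}
    (hz : z ∈ Lambda ω) : a ^ n * z ∈ Lambda ω := by
  induction n with
  | zero => simpa using hz
  | succ n ih => rw [pow_succ', mul_assoc]; exact hab _ ih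

/-- The preimages of the lattice under the powers of an expanding multiplication are dense. -/
theorem exists_ne_zero_pow_mul_mem_Lambda (hω : 0 < ω.im) (ha : 1 < ‖a‖) {O : Set ℂ}
    (hO : IsOpen O) (hne : O.Nonempty) : ∃ d ∈ O, d ≠ 0 ∧ ∃ n : ℕ, a ^ n * d ∈ Lambda ω := by
  obtain ⟨w, hw, hw0⟩ : (O ∩ {0}ᶜ).Nonempty :=
    (dense_compl_singleton (0 : ℂ)).inter_open_nonempty O hO hne
  obtain ⟨ε, hε, hball⟩ := Metric.isOpen_iff.1 (hO.inter isOpen_compl_singleton) w ⟨hw, hw0⟩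
  obtain ⟨n, hn⟩ := pow_unbounded_of_one_lt ((1 + ‖ω‖) / ε) ha
  obtain ⟨l, hl, hle⟩ := exists_mem_Lambda_norm_sub_le hω (a ^ n * w)
  have hapos : 0 < ‖a‖ ^ n := pow_pos (one_pos.trans ha) n
  have han : a ^ n ≠ 0 := by rw [← norm_pos_iff, norm_pow]; exact hapos
  have hmem : l / a ^ n ∈ ball w ε := by
    rw [mem_ball', dist_eq_norm]
    have : w - l / a ^ n = (a ^ n * w - l) / a ^ n := by field_simp
    rw [this, norm_div, norm_pow, div_lt_iff₀ hapos]
    rw [div_lt_iff₀ hε] at hn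
    linarith
  exact ⟨l / a ^ n, (hball hmem).1, (hball hmem).2, n, by rwa [mul_div_cancel₀ _ han]⟩

/-- A continuous map from a connected set of the torus to a countable set is constant. -/
theorem exists_eq_of_mapsTo_countable {ω : ℂ} (hω : 0 < ω.im) {X : Type*} [TopologicalSpace X]
    {E : Set X} (hE : IsConnected E) {h : X → ℂ ⧸ Lambda ω} (hh : ContinuousOn h E)
    {C : Set (ℂ ⧸ Lambda ω)} (hC : C.Countable) (hhC : MapsTo h E C) : ∃ c, ∀ e ∈ E, h e = c := by
  have := isClosed_Lambda hω
  obtain ⟨e₀, he₀⟩ := hE.nonempty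
  have hconst := hC.isTotallyDisconnected _ hhC.image_subset (hE.isPreconnected.image _ hh)
  exact ⟨h e₀, fun e he ↦ hconst (mem_image_of_mem _ he) (mem_image_of_mem _ he₀)⟩

end Torus

section Rotation

variable {a : ℂ}

/-- If no power of `a` is real, every direction is a limit of directions of powers of `a`. -/
theorem mapClusterPt_direction_pow (ha : ∀ k : ℕ, 0 < k → (a ^ k).im ≠ 0) {u : ℂ}
    (hu : ‖u‖ = 1) : MapClusterPt u atTop fun n : ℕ ↦ a ^ n / (‖a‖ : ℂ) ^ n := by
  have ha0 : a ≠ 0 := by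
    rintro rfl
    exact ha 1 one_pos (by simp)
  have hna : (‖a‖ : ℂ) ≠ 0 := by simpa using ha0
  have : Fact (0 < 2 * Real.pi) := ⟨Real.two_pi_pos⟩
  set g : AddCircle (2 * Real.pi) → ℂ := fun θ ↦ AddCircle.toCircle θ with hg
  have hgc : Continuous g := continuous_subtype_val.comp AddCircle.continuous_toCircle
  have hgarg : ∀ w : ℂ, w ≠ 0 → g (w.arg : ℝ) = w / ‖w‖ := by
    intro w hw
    have hw' : (‖w‖ : ℂ) ≠ 0 := by simpa using hw
    rw [hg, eq_div_iff hw', mul_comm]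
    conv_rhs => rw [← norm_mul_exp_arg_mul_I w]
    simp [AddCircle.toCircle_apply_mk, Circle.coe_exp]
  have hgn : ∀ n : ℕ, g (n • (a.arg : AddCircle (2 * Real.pi))) = a ^ n / (‖a‖ : ℂ) ^ n := by
    intro n
    rw [← div_pow, ← hgarg a ha0, hg]
    simp [AddCircle.toCircle_nsmul]
  have hdense : DenseRange fun n : ℤ ↦ n • (a.arg : AddCircle (2 * Real.pi)) := by
    rw [AddCircle.denseRange_zsmul_iff, addOrderOf_eq_zero_iff']
    intro n hn h0
    have h1 := hgn n
    have h2 : g 0 = 1 := by simp [hg, AddCircle.toCircle_zero]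
    rw [h0, h2, eq_div_iff (pow_ne_zero _ hna), one_mul] at h1
    apply ha n hn
    rw [← h1, ← ofReal_pow, ofReal_im]
  have hu0 : u ≠ 0 := norm_ne_zero_iff.1 (hu ▸ one_ne_zero)
  have hcl : MapClusterPt (u.arg : AddCircle (2 * Real.pi)) atTop
      fun n : ℕ ↦ n • (a.arg : AddCircle (2 * Real.pi)) :=
    ((mapClusterPt_atTop_nsmul_tfae _ _).out 0 3).2 (hdense _)
  have := hcl.continuousAt_comp hgc.continuousAt
  simpa [Function.comp_def, hgn, hgarg u hu0, hu] using this

/-- If no power of `a` is real, some power of `a` is a large positive multiple of `a + x` with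
`x` in a prescribed range. -/
theorem exists_pow_eq_mul_add (h1 : 1 < ‖a‖) (ha : ∀ k : ℕ, 0 < k → (a ^ k).im ≠ 0)
    {t : ℝ} (ht : 0 < t) (R : ℝ) :
    ∃ n : ℕ, 0 < n ∧ ∃ r x : ℝ, a ^ n = r * (a + x) ∧ t / 4 < x ∧ x < t / 2 ∧ R ≤ r := by
  have him : a.im ≠ 0 := by simpa using ha 1 one_pos
  set β : ℂ → ℝ := fun w ↦ w.im / a.im with hβ
  set α : ℂ → ℝ := fun w ↦ w.re - a.re * β w with hα
  have hβc : Continuous β := by fun_prop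
  have hαc : Continuous α := by fun_prop
  have hαβ : ∀ w, w = α w + β w * a := by
    intro w
    apply Complex.ext <;> simp [hα, hβ]
    · ring
    · field_simp
  set y : ℂ := a + (3 * t / 8 : ℝ) with hy
  have hy0 : 0 < ‖y‖ := by
    rw [norm_pos_iff]
    intro h
    apply him
    simpa [hy] using congrArg Complex.im h
  set u : ℂ := y / ‖y‖ with hu
  have hβu : β u = ‖y‖⁻¹ := by
    have : u.im = a.im / ‖y‖ := by rw [hu, div_ofReal_im, hy]; simp
    rw [hβ]; simp only [this]; field_simp
  have hαu : α u = 3 * t / 8 * ‖y‖⁻¹ := by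
    have : u.re = (a.re + 3 * t / 8) / ‖y‖ := by rw [hu, div_ofReal_re, hy, add_re, ofReal_re]
    simp only [hα, this, hβu]; field_simp; ring
  have hδ : 0 < ‖y‖⁻¹ := inv_pos.2 hy0
  have hV : {w : ℂ | ‖y‖⁻¹ / 2 < β w ∧ t / 4 * β w < α w ∧ α w < t / 2 * β w} ∈ 𝓝 u := by
    refine IsOpen.mem_nhds ?_ ⟨?_, ?_, ?_⟩
    · exact (isOpen_lt continuous_const hβc).inter
        ((isOpen_lt (by fun_prop) hαc).inter (isOpen_lt hαc (by fun_prop)))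
    · rw [hβu]; linarith
    · rw [hβu, hαu]; nlinarith [mul_pos ht hδ]
    · rw [hβu, hαu]; nlinarith [mul_pos ht hδ]
  have hfreq := (mapClusterPt_direction_pow ha (u := u) (by simp [hu, hy0.ne'])).frequently hV
  have hev : ∀ᶠ n : ℕ in atTop, R ≤ ‖a‖ ^ n * (‖y‖⁻¹ / 2) :=
    ((tendsto_pow_atTop_atTop_of_one_lt h1).atTop_mul_const (half_pos hδ)).eventually_ge_atTop R
  obtain ⟨n, ⟨hb, hl, hr⟩, hR, hn⟩ :=
    (hfreq.and_eventually (hev.and (eventually_gt_atTop 0))).exists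
  set w := a ^ n / (‖a‖ : ℂ) ^ n with hw
  have hb0 : 0 < β w := (half_pos hδ).trans hb
  have hpow : 0 < ‖a‖ ^ n := pow_pos (one_pos.trans h1) n
  refine ⟨n, hn, ‖a‖ ^ n * β w, α w / β w, ?_, ?_, ?_, ?_⟩
  · have e1 : a ^ n = (‖a‖ : ℂ) ^ n * w := by
      rw [hw, mul_div_cancel₀]; exact_mod_cast hpow.ne'
    have hbc : (β w : ℂ) ≠ 0 := by exact_mod_cast hb0.ne'
    rw [e1]
    conv_lhs => rw [hαβ w]
    push_cast
    field_simp
    ring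
  · rwa [lt_div_iff₀ hb0]
  · rwa [div_lt_iff₀ hb0]
  · exact hR.trans (mul_le_mul_of_nonneg_left hb.le hpow.le)

/-- An arithmetic progression with small step comes close to an integer within a bounded number
of steps. -/
theorem exists_int_le_add_mul_le {t x : ℝ} (ht : 0 < t) (hx : t / 4 < x) (hxt : x < t / 2)
    (c M : ℝ) : ∃ m l : ℤ, M ≤ m ∧ m ≤ M + 4 / t + 2 ∧ l ≤ c + m * x ∧ c + m * x ≤ l + t := by
  have hx0 : 0 < x := by linarith
  set m₀ := ⌈M⌉ with hm₀
  set l := ⌈c + m₀ * x⌉ with hl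
  set m := ⌈(l - c) / x⌉ with hm
  have a1 : M ≤ m₀ := Int.le_ceil M
  have a2 : (m₀ : ℝ) < M + 1 := Int.ceil_lt_add_one M
  have b1 : c + m₀ * x ≤ l := Int.le_ceil _
  have b2 : (l : ℝ) < c + m₀ * x + 1 := Int.ceil_lt_add_one _
  have c1 : (l - c) / x ≤ m := Int.le_ceil _
  have c2 : (m : ℝ) < (l - c) / x + 1 := Int.ceil_lt_add_one _
  have d1 : (m₀ : ℝ) ≤ (l - c) / x := by rw [le_div_iff₀ hx0]; linarith
  have d2 : (l - c) / x ≤ m₀ + 4 / t := by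
    rw [div_le_iff₀ hx0, add_mul]
    have : 1 ≤ 4 / t * x := by rw [div_mul_eq_mul_div, le_div_iff₀ ht]; linarith
    linarith
  have c3 : l - c ≤ m * x := (div_le_iff₀ hx0).1 c1
  have c4 : (m - 1) * x < l - c := by rw [← lt_div_iff₀ hx0]; linarith
  exact ⟨m, l, by linarith, by linarith, by linarith, by linarith⟩

/-- A segment whose lifts stay disjoint from their translates under the affine dynamics does not
point in a lattice direction. -/
theorem smul_notMem_Lambda {ω : ℂ} (hab : ∀ z ∈ Lambda ω, a * z ∈ Lambda ω) (h1 : 1 < ‖a‖) {v : ℂ}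
    (hinj : ∀ n : ℕ, ∀ p ∈ Icc (0 : ℝ) 1, a ^ n * (p * v) ∈ Lambda ω → p = 0)
    (hwander : ∀ n : ℕ, 0 < n → ∃ D : ℂ, ∀ p ∈ Icc (0 : ℝ) 1, ∀ q ∈ Icc (0 : ℝ) 1,
      D + (a ^ n * p - q) * v ∉ Lambda ω)
    {s : ℝ} (hs : s ≠ 0) : s * v ∉ Lambda ω := by
  intro hsv
  have habs : (|s| : ℝ) * v ∈ Lambda ω := by
    rcases abs_choice s with h | h
    · rwa [h]
    · rw [h, ofReal_neg, neg_mul]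
      exact neg_mem hsv
  clear hsv
  have hpos : 0 < |s| := abs_pos.2 hs
  generalize |s| = s' at habs hpos
  clear hs s
  by_cases hre : ∃ k : ℕ, 0 < k ∧ (a ^ k).im = 0
  · obtain ⟨k, hk, him⟩ := hre
    have hk1 : 1 < ‖a‖ ^ k := one_lt_pow₀ h1 hk.ne'
    obtain ⟨j, hj⟩ := pow_unbounded_of_one_lt s' hk1
    set m : ℝ := (a ^ k).re
    have hm : a ^ k = m := Complex.ext rfl (by simpa using him)
    have hmn : ‖a‖ ^ k = |m| := by rw [← norm_pow, hm, norm_real, Real.norm_eq_abs]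
    have hjpos : 0 < (‖a‖ ^ k) ^ j := by positivity
    have hmem : a ^ (k * j) * ((s' / (‖a‖ ^ k) ^ j : ℝ) * v) ∈ Lambda ω := by
      have : a ^ (k * j) * ((s' / (‖a‖ ^ k) ^ j : ℝ) * v) =
          ((m ^ j / |m| ^ j : ℝ) : ℂ) * (s' * v) := by
        rw [pow_mul, hm, hmn]; push_cast; ring
      rw [this, ← div_pow]
      rcases abs_choice m with h | h
      · have : m ≠ 0 := by rintro h0; rw [hmn, h0, abs_zero] at hk1; linarith
        rw [h, div_self this, one_pow, ofReal_one, one_mul]; exact habs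
      · have : m ≠ 0 := by rintro h0; rw [hmn, h0, abs_zero] at hk1; linarith
        rw [h, div_neg, div_self this]
        rcases neg_one_pow_eq_or ℝ j with h' | h' <;> rw [h']
        · simpa using habs
        · simpa using neg_mem habs
    have := hinj _ _ ⟨(div_pos hpos hjpos).le, (div_le_one hjpos).2 hj.le⟩ hmem
    exact (div_pos hpos hjpos).ne' this
  · push Not at hre
    have him : a.im ≠ 0 := by simpa using hre 1 one_pos
    set t := s'⁻¹ with ht
    have htpos : 0 < t := inv_pos.2 hpos
    obtain ⟨n, hn, r, x, hrx, hx, hxt, hr⟩ := exists_pow_eq_mul_add h1 hre htpos ((4 / t + 2) / t)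
    rw [div_le_iff₀ htpos] at hr
    obtain ⟨D, hD⟩ := hwander n hn
    set l₀ : ℂ := s' * v with hl₀
    have hv : v = t * l₀ := by
      rw [hl₀, ht, ofReal_inv, inv_mul_cancel_left₀]
      exact_mod_cast hpos.ne'
    obtain ⟨D₁, D₂, hD₁₂⟩ : ∃ D₁ D₂ : ℝ, D = l₀ * (D₁ + D₂ * a) := by
      have hl₀0 : l₀ ≠ 0 := by
        intro h
        have := hinj 0 1 (by simp) (by rw [hv, h]; simp)
        exact one_ne_zero this
      obtain ⟨e, he⟩ := exists_coordinates (u := 1) (v := a) (by simpa using him)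
      obtain ⟨⟨D₁, D₂⟩, h⟩ := e.surjective (D / l₀)
      refine ⟨D₁, D₂, ?_⟩
      rw [he, mul_one, eq_div_iff hl₀0] at h
      rw [← h, mul_comm]
    obtain ⟨m, l, hm, hm', hl, hl'⟩ := exists_int_le_add_mul_le htpos hx hxt (D₁ - D₂ * x) D₂
    have h4 : 0 < 4 / t := by positivity
    have hrt : 0 < r * t := by linarith
    have hrpos : 0 < r := pos_of_mul_pos_left hrt htpos.le
    refine hD ((m - D₂) / (r * t)) ⟨div_nonneg (by linarith) hrt.le, ?_⟩
      ((D₁ - D₂ * x + m * x - l) / t) ⟨div_nonneg (by linarith) htpos.le, ?_⟩ ?_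
    · rw [div_le_one hrt]; linarith
    · rw [div_le_one htpos]; linarith
    · have : D + (a ^ n * ((m - D₂) / (r * t) : ℝ) - ((D₁ - D₂ * x + m * x - l) / t : ℝ)) * v =
          l • l₀ + m • (a * l₀) := by
        have hr0 : (r : ℂ) ≠ 0 := by exact_mod_cast hrpos.ne'
        have ht0 : (t : ℂ) ≠ 0 := by exact_mod_cast htpos.ne'
        rw [hD₁₂, hrx, hv, zsmul_eq_mul, zsmul_eq_mul]
        push_cast
        field_simp
        ring
      rw [this]
      exact add_mem (zsmul_mem habs _) (zsmul_mem (hab _ habs) _)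

end Rotation

end Auxiliary

open Set
open scoped Pointwise

/-- An eventually simply-connected wandering continuum of an affine torus covering
is a line segment contained in an infinite geodesic of the flat torus. -/
theorem wandering_continuum_is_segment_in_geodesic (ω a b : ℂ) (hω : 0 < ω.im)
    (hab : ∀ z ∈ Lambda ω, a * z ∈ Lambda ω)
    (hdeg : 2 ≤ Complex.normSq a)
    (A : ℂ ⧸ Lambda ω → ℂ ⧸ Lambda ω)
    (hA : ∀ z : ℂ, A (pr ω z) = pr ω (a * z + b))
    (E : Set (ℂ ⧸ Lambda ω)) (hE : IsContinuum E) (hW : Wandering A E)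
    (hSC : ∃ N : ℕ, ∀ n ≥ N, IsSCContinuum ω (A^[n] '' E)) :
    ∃ L B : Set ℂ, IsLine L ∧ Set.InjOn (pr ω) L ∧ IsSegment B ∧ B ⊆ L ∧
      E = pr ω '' B := by
  have h1 : 1 < ‖a‖ := by
    rw [normSq_eq_norm_sq] at hdeg
    nlinarith [norm_nonneg a]
  have han : ∀ n : ℕ, a ^ n ≠ 0 := fun n ↦ pow_ne_zero n (norm_pos_iff.1 (one_pos.trans h1))
  obtain ⟨hEc, hEconn, hEnt⟩ := hE
  obtain ⟨N, hN⟩ := hSC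
  set T : ℂ → ℂ := fun z ↦ a * z + b with hT
  have hTc : ∀ n, Continuous T^[n] := fun n ↦ Continuous.iterate (by fun_prop) n
  have hTsub : ∀ n z w, T^[n] z - T^[n] w = a ^ n * (z - w) := iterate_affine_sub
  have hsemi : Function.Semiconj (pr ω) T A := fun z ↦ (hA z).symm
  have hiter : ∀ n z, A^[n] (pr ω z) = pr ω (T^[n] z) :=
    fun n z ↦ (hsemi.iterate_right n z).symm
  have hAc : Continuous A :=
    isQuotientMap_pr.continuous_iff.2 (hsemi.comp_eq ▸ continuous_pr.comp (hTc 1))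
  obtain ⟨U, hU, hUsc, hEU, -⟩ := hN N le_rfl
  obtain ⟨σ, hσ, hσU⟩ := exists_section_pr hω hU hUsc
  set G : ℂ ⧸ Lambda ω → ℂ := fun e ↦ σ (A^[N] e) with hG
  have hGc : ContinuousOn G E :=
    hσ.comp (hAc.iterate N).continuousOn fun e he ↦ hEU (mem_image_of_mem _ he)
  have hprG : ∀ e ∈ E, pr ω (G e) = A^[N] e := fun e he ↦ hσU _ (hEU (mem_image_of_mem _ he))
  have hprTG : ∀ n, ∀ e ∈ E, pr ω (T^[n] (G e)) = A^[n + N] e := by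
    intro n e he
    rw [← hiter, hprG e he, Function.iterate_add_apply]
  have hFconn : IsConnected (G '' E) := hEconn.image _ hGc
  have hinj : ∀ n : ℕ, ∀ x ∈ G '' E, ∀ y ∈ G '' E, a ^ n * (x - y) ∈ Lambda ω → x = y := by
    intro n x hx y hy hxy
    obtain ⟨V, hV, hVsc, hEV, -⟩ := hN (n + N) (Nat.le_add_left _ _)
    have hmaps : MapsTo (pr ω) (T^[n] '' (G '' E)) V := by
      rintro _ ⟨_, ⟨e, he, rfl⟩, rfl⟩
      rw [hprTG n e he]
      exact hEV (mem_image_of_mem _ he)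
    have hTxy := injOn_pr_of_isPreconnected hω hV hVsc
      (hFconn.isPreconnected.image _ (hTc n).continuousOn) hmaps (mem_image_of_mem _ hx)
      (mem_image_of_mem _ hy) (pr_eq_pr_iff.2 (hTsub n x y ▸ hxy))
    have := hTsub n x y
    rw [hTxy, sub_self, eq_comm, mul_eq_zero, or_iff_right (han n)] at this
    exact sub_eq_zero.1 this
  have hwander : ∀ n : ℕ, 0 < n → ∀ x ∈ G '' E, ∀ y ∈ G '' E, T^[n] x - y ∉ Lambda ω := by
    rintro n hn _ ⟨e, he, rfl⟩ _ ⟨e', he', rfl⟩ h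
    rw [← pr_eq_pr_iff, hprTG n e he, hprG e' he'] at h
    have hmem : A^[N] e' ∈ A^[n + N] '' E ∩ A^[N] '' E :=
      ⟨⟨e, he, h⟩, mem_image_of_mem _ he'⟩
    rw [hW (n + N) N (by omega)] at hmem
    exact hmem
  have hinterior : interior (G '' E - G '' E) = ∅ := by
    by_contra hne
    obtain ⟨d, hd, hd0, n, hn⟩ := exists_ne_zero_pow_mul_mem_Lambda hω h1 isOpen_interior
      (nonempty_iff_ne_empty.2 hne)
    obtain ⟨x, hx, y, hy, rfl⟩ := interior_subset hd
    exact hd0 (sub_eq_zero.2 (hinj n x hx y hy hn))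
  obtain ⟨z₀, v, hF⟩ := exists_segment_of_interior_sub_self_eq_empty
    (hEc.image_of_continuousOn hGc) hFconn hinterior
  set τ : ℂ → ℂ := fun w ↦ (w - T^[N] 0) / a ^ N with hτ
  obtain ⟨c, hc⟩ : ∃ c, ∀ e ∈ E, e - pr ω (τ (G e)) = c := by
    refine exists_eq_of_mapsTo_countable hω hEconn (C := pr ω '' {k | a ^ N * k ∈ Lambda ω})
      (continuousOn_id.sub (continuous_pr.comp_continuousOn ?_)) (Countable.image ?_ _) ?_
    · exact (hGc.sub continuousOn_const).div_const _
    · exact countable_Lambda.preimage (mul_right_injective₀ (han N))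
    · intro e he
      obtain ⟨z, rfl⟩ := pr_surjective e
      refine ⟨z - τ (G (pr ω z)), ?_, rfl⟩
      have h2 := hprG _ he
      rw [hiter, eq_comm, pr_eq_pr_iff] at h2
      have h3 : a ^ N * (z - τ (G (pr ω z))) = T^[N] z - G (pr ω z) := by
        have := hTsub N z 0
        rw [mul_sub, hτ, mul_div_cancel₀ _ (han N)]
        linear_combination -this
      rwa [mem_ofPred_eq, h3]
  obtain ⟨κ, rfl⟩ := pr_surjective c
  have hE' : ∀ e ∈ E, e = pr ω (τ (G e) + κ) := by
    intro e he
    rw [pr_add, ← hc e he, add_sub_cancel]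
  have hτseg : ∀ t : ℝ, τ (z₀ + t * v) + κ = τ z₀ + κ + t * (v / a ^ N) := by
    intro t
    simp only [hτ]
    ring
  have hv : v ≠ 0 := by
    rintro rfl
    have hGz : ∀ e ∈ E, G e = z₀ := by
      intro e he
      have := mem_image_of_mem G he
      rw [hF] at this
      obtain ⟨t, -, ht⟩ := this
      simpa using ht
    obtain ⟨x, hx, y, hy, hxy⟩ := hEnt
    apply hxy
    rw [hE' x hx, hE' y hy, hGz x hx, hGz y hy]
  have hmemF : ∀ p ∈ Icc (0 : ℝ) 1, z₀ + p * v ∈ G '' E := by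
    intro p hp
    rw [hF]
    exact ⟨p, hp, rfl⟩
  have hdir : ∀ s : ℝ, s ≠ 0 → s * v ∉ Lambda ω := by
    intro s hs
    refine smul_notMem_Lambda hab h1 (fun n p hp h ↦ ?_) (fun n hn ↦ ?_) hs
    · have := hinj n _ (hmemF p hp) _ (hmemF 0 (by simp)) (by simpa using h)
      simpa [hv] using this
    · refine ⟨T^[n] z₀ - z₀, fun p hp q hq h ↦ hwander n hn _ (hmemF p hp) _ (hmemF q hq) ?_⟩
      have := hTsub n (z₀ + p * v) z₀
      convert h using 1
      linear_combination this
  have hva : v / a ^ N ≠ 0 := div_ne_zero hv (han N)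
  refine ⟨{z | ∃ t : ℝ, z = τ z₀ + κ + t * (v / a ^ N)},
    {z | ∃ t : ℝ, t ∈ Icc (0 : ℝ) 1 ∧ z = τ z₀ + κ + t * (v / a ^ N)},
    ⟨_, _, hva, rfl⟩, ?_, ⟨_, _, hva, rfl⟩, fun z ⟨t, _, h⟩ ↦ ⟨t, h⟩, ?_⟩
  · rintro _ ⟨s, rfl⟩ _ ⟨t, rfl⟩ h
    rw [pr_eq_pr_iff] at h
    have h2 := pow_mul_mem_Lambda hab N h
    have h3 : a ^ N * (τ z₀ + κ + s * (v / a ^ N) - (τ z₀ + κ + t * (v / a ^ N))) =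
        (s - t : ℝ) * v := by
      have := han N
      push_cast
      field_simp
      ring
    rw [h3] at h2
    have h4 : s = t := by
      by_contra hne
      exact hdir _ (sub_ne_zero.2 hne) h2
    rw [h4]
  · ext e
    constructor
    · intro he
      have := mem_image_of_mem G he
      rw [hF] at this
      obtain ⟨t, ht, hGe⟩ := this
      exact ⟨_, ⟨t, ht, rfl⟩, by rw [← hτseg, ← hGe, ← hE' e he]⟩
    · rintro ⟨_, ⟨t, ht, rfl⟩, rfl⟩
      obtain ⟨e, he, hGe⟩ := hmemF t ht
      rw [← hτseg, ← hGe, ← hE' e he]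
      exact he
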